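/- Let λ ∈ F \ F_q, let t = [F_q(λ) : F_q], let k be an integer with 1 ≤ k < t and 2k > t, and let S = ⟨1, λ, …, λ^{k−1}⟩_{F_q}. Then ω_{2i}(Orb(S)) = (q+1)·q^{2i−1} for every i ∈ {1,…,t−k−1}; ω_{2(t−k)}(Orb(S)) = (q^t − q^{2(t−k)−1})/(q − 1); ω_{2i}(Orb(S)) = 0 for every i ∈ {t−k+1,…,k−1} (when t−k+1 ≤ k−1); and ω_{2k}(Orb(S)) = (q^n − q^t)/(q − 1). -/

import Mathlib

open Module

section Defs

variable {F : Type*} [Field F]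

/-- The subspace `α·S = {α * s : s ∈ S}` of `F`, for `S` a subspace over the subfield `Fq`. -/
noncomputable def smulSub (Fq : Subfield F) (α : F) (S : Submodule Fq F) : Submodule Fq F :=
  S.map (LinearMap.mulLeft Fq α)

/-- The one-orbit cyclic subspace code `Orb(S) = {αS : α ∈ Fˣ}`. -/
def Orb (Fq : Subfield F) (S : Submodule Fq F) : Set (Submodule Fq F) :=
  {T | ∃ α : F, α ≠ 0 ∧ T = smulSub Fq α S}

/-- The number of subspaces `αS` (for `α ∈ Fˣ`) with `dim_{Fq}(S ∩ αS) = d`.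
For `dim_{Fq} S = k` and `d = k - i` this is the weight-distribution entry `ω_{2i}(Orb S)`. -/
noncomputable def wt (Fq : Subfield F) (S : Submodule Fq F) (d : ℕ) : ℕ :=
  Set.ncard {T | T ∈ Orb Fq S ∧ finrank Fq ↥(S ⊓ T) = d}

/-- The stabilizer `H(V) = {x ∈ Fˣ : xV = V} ∪ {0}` of a set `V ⊆ F`. -/
def HStabSet (V : Set F) : Set F :=
  {x : F | x ≠ 0 ∧ (fun y => x * y) '' V = V} ∪ {0}

/-- An `Fqt`-subspace of `F` viewed as an `Fq`-subspace, for `Fq ≤ Fqt`. -/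
def toFqSub (Fq Fqt : Subfield F) (h : Fq ≤ Fqt) (W : Submodule Fqt F) : Submodule Fq F where
  carrier := W
  add_mem' := fun ha hb => W.add_mem ha hb
  zero_mem' := W.zero_mem
  smul_mem' := fun c _ hx => W.smul_mem (⟨c.1, h c.2⟩ : Fqt) hx

/-- The subfield `Fqt` viewed as an `Fq`-subspace of `F`, for `Fq ≤ Fqt`. -/
def subfieldModule (Fq Fqt : Subfield F) (h : Fq ≤ Fqt) : Submodule Fq F where
  carrier := Fqt
  add_mem' := fun ha hb => Fqt.add_mem ha hb
  zero_mem' := Fqt.zero_mem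
  smul_mem' := fun c _ hx => Fqt.mul_mem (h c.2) hx

/-- `Orb(S)` is an `r`-FWS code, where `k = dim_{Fq} S`: the weight-distribution entries
`ω_{2i}` are positive for `i ∈ {1, …, k - r}` and zero for `i ∈ {k - r + 1, …, k}`. -/
def IsRFWS (Fq : Subfield F) (S : Submodule Fq F) (k r : ℕ) : Prop :=
  (∀ i, 1 ≤ i → i ≤ k - r → 0 < wt Fq S (k - i)) ∧
  (∀ i, k - r + 1 ≤ i → i ≤ k → wt Fq S (k - i) = 0)

end Defs

section PolySpan

open Polynomial

variable {F : Type*} [Field F] {Fq : Subfield F} {lam : F}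

/-- The subspace of values at `lam` of the polynomials of degree less than `m`. -/
noncomputable def polySpan (Fq : Subfield F) (lam : F) (m : ℕ) : Submodule Fq F :=
  (degreeLT Fq m).map (aeval lam).toLinearMap

lemma mem_polySpan {m : ℕ} {x : F} :
    x ∈ polySpan Fq lam m ↔ ∃ f : Fq[X], f.degree < m ∧ aeval lam f = x := by
  simp [polySpan, mem_degreeLT]

lemma mem_smulSub {α x : F} {S : Submodule Fq F} :
    x ∈ smulSub Fq α S ↔ ∃ y ∈ S, α * y = x := by
  simp [smulSub]

lemma span_pow_eq_polySpan (m : ℕ) :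
    Submodule.span Fq {x : F | ∃ j < m, x = lam ^ j} = polySpan Fq lam m := by
  classical
  rw [polySpan, degreeLT_eq_span_X_pow, Submodule.map_span]
  congr 1
  ext x
  simp [eq_comm]

instance (m : ℕ) : Module.Finite Fq (degreeLT Fq m) :=
  Module.Finite.equiv (degreeLTEquiv Fq m).symm

lemma finrank_degreeLT (m : ℕ) : finrank Fq (degreeLT Fq m) = m := by
  simpa using (degreeLTEquiv Fq m).finrank_eq

instance (m : ℕ) : Module.Finite Fq (polySpan Fq lam m) := by
  unfold polySpan; infer_instance

instance (α : F) (S : Submodule Fq F) [Module.Finite Fq S] :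
    Module.Finite Fq (smulSub Fq α S) := by
  unfold smulSub; infer_instance

lemma eq_zero_of_aeval_eq_zero {f : Fq[X]} (hf : f.degree < (minpoly Fq lam).natDegree)
    (h : aeval lam f = 0) : f = 0 := by
  by_contra hne
  have h1 := minpoly.degree_le_of_ne_zero Fq lam hne h
  have h2 : f.degree < (minpoly Fq lam).degree := hf.trans_le <| by
    rw [degree_eq_natDegree]
    rintro h0
    rw [h0] at hf
    simp only [natDegree_zero, Nat.cast_zero] at hf
    exact hne (by simpa using hf)
  exact absurd h1 (not_le.mpr h2)

lemma finrank_polySpan {m : ℕ} (hm : m ≤ (minpoly Fq lam).natDegree) :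
    finrank Fq (polySpan Fq lam m) = m := by
  have hinj : Function.Injective ((aeval lam).toLinearMap.domRestrict (degreeLT Fq m)) := by
    rw [injective_iff_map_eq_zero]
    rintro ⟨f, hf⟩ h
    have := eq_zero_of_aeval_eq_zero
      ((mem_degreeLT.mp hf).trans_le (by exact_mod_cast hm)) h
    simpa using this
  have := LinearMap.finrank_range_of_inj hinj
  rw [LinearMap.range_domRestrict, finrank_degreeLT] at this
  exact this

lemma finrank_smulSub {α : F} (hα : α ≠ 0) (S : Submodule Fq F) :
    finrank Fq (smulSub Fq α S) = finrank Fq S := by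
  have hinj : Function.Injective (LinearMap.mulLeft Fq α) := mul_right_injective₀ hα
  exact (Submodule.equivMapOfInjective _ hinj S).finrank_eq.symm

/-- Rank-nullity for a submodule, as an upper bound. -/
lemma finrank_le_add_of_map_le_of_inf_ker_le {K V W : Type*} [Field K] [AddCommGroup V]
    [Module K V] [AddCommGroup W] [Module K W] (Φ : V →ₗ[K] W) (P B : Submodule K V)
    (A : Submodule K W) [Module.Finite K P] [Module.Finite K A] [Module.Finite K B]
    (hA : P.map Φ ≤ A) (hB : P ⊓ LinearMap.ker Φ ≤ B) :
    finrank K P ≤ finrank K A + finrank K B := by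
  have h := LinearMap.finrank_range_add_finrank_ker (Φ.domRestrict P)
  rw [LinearMap.range_domRestrict] at h
  have h1 := Submodule.finrank_mono hA
  have h2 : finrank K (LinearMap.ker (Φ.domRestrict P)) ≤ finrank K B := by
    have e := (Submodule.equivMapOfInjective _ P.injective_subtype
      (LinearMap.ker (Φ.domRestrict P))).finrank_eq
    rw [e]
    apply Submodule.finrank_mono
    refine le_trans ?_ hB
    rintro _ ⟨⟨x, hx⟩, hk, rfl⟩
    exact ⟨hx, hk⟩
  omega

variable {α : F} {f₀ g₀ : Fq[X]}

lemma sub_le_finrank_inf (hα : α ≠ 0) (hg : aeval lam g₀ ≠ 0)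
    (hfg : aeval lam f₀ = α * aeval lam g₀) {m : ℕ} (hm : m ≤ (minpoly Fq lam).natDegree) :
    m - max f₀.natDegree g₀.natDegree ≤
      finrank Fq ↥(polySpan Fq lam m ⊓ smulSub Fq α (polySpan Fq lam m)) := by
  set i := max f₀.natDegree g₀.natDegree with hi
  rw [← finrank_polySpan (Fq := Fq) (lam := lam) (m := m - i) (by omega),
    ← finrank_smulSub (Fq := Fq) (α := aeval lam f₀) (by rw [hfg]; exact mul_ne_zero hα hg)]
  apply Submodule.finrank_mono
  intro x hx
  obtain ⟨y, hy, rfl⟩ := mem_smulSub.mp hx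
  obtain ⟨h, hh, rfl⟩ := mem_polySpan.mp hy
  have key : ∀ p : Fq[X], p.natDegree ≤ i → (p * h).degree < m := by
    intro p hp
    rcases eq_or_ne h 0 with rfl | hne
    · simp
    · rw [degree_eq_natDegree hne, Nat.cast_lt] at hh
      refine degree_le_natDegree.trans_lt ?_
      have := natDegree_mul_le (p := p) (q := h)
      exact_mod_cast (by omega)
  refine ⟨mem_polySpan.mpr ⟨f₀ * h, key _ (le_max_left _ _), by simp⟩,
    mem_smulSub.mpr ⟨aeval lam (g₀ * h), mem_polySpan.mpr ⟨_, key _ (le_max_right _ _), rfl⟩, ?_⟩⟩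
  rw [hfg, map_mul, mul_assoc]

lemma finrank_inf_le (hα : α ≠ 0) (hcop : IsCoprime f₀ g₀) (hg : aeval lam g₀ ≠ 0)
    (hfg : aeval lam f₀ = α * aeval lam g₀) (m : ℕ) :
    finrank Fq ↥(polySpan Fq lam m ⊓ smulSub Fq α (polySpan Fq lam m)) ≤
      (max f₀.natDegree g₀.natDegree + m - (minpoly Fq lam).natDegree) +
        (m - max f₀.natDegree g₀.natDegree) := by
  set i := max f₀.natDegree g₀.natDegree with hi
  set t := (minpoly Fq lam).natDegree with ht
  have hg0 : g₀ ≠ 0 := by rintro rfl; simp at hg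
  have hf0 : f₀ ≠ 0 := by
    rintro rfl
    exact mul_ne_zero hα hg (by simpa using hfg.symm)
  let ψ : Fq[X] × Fq[X] →ₗ[Fq] F := (aeval lam).toLinearMap.comp (LinearMap.fst _ _ _) -
    (LinearMap.mulLeft Fq α).comp ((aeval lam).toLinearMap.comp (LinearMap.snd _ _ _))
  let Φ : Fq[X] × Fq[X] →ₗ[Fq] Fq[X] := (LinearMap.mulLeft Fq g₀).comp (LinearMap.fst _ _ _) -
    (LinearMap.mulLeft Fq f₀).comp (LinearMap.snd _ _ _)
  let ι : Fq[X] →ₗ[Fq] Fq[X] × Fq[X] :=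
    (LinearMap.mulLeft Fq f₀).prod (LinearMap.mulLeft Fq g₀)
  let Q : Submodule Fq (Fq[X] × Fq[X]) := (degreeLT Fq m).prod (degreeLT Fq m)
  let P := Q ⊓ LinearMap.ker ψ
  have hQ : Module.Finite Fq Q := Module.Finite.iff_fg.mpr
    ((Module.Finite.iff_fg.mp inferInstance).prod (Module.Finite.iff_fg.mp inferInstance))
  have hP : Module.Finite Fq P := Submodule.finiteDimensional_of_le inf_le_left
  have hle : polySpan Fq lam m ⊓ smulSub Fq α (polySpan Fq lam m) ≤
      P.map ((aeval lam).toLinearMap.comp (LinearMap.fst Fq Fq[X] Fq[X])) := by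
    rintro x ⟨hx1, hx2⟩
    obtain ⟨y, hy, rfl⟩ := mem_smulSub.mp hx2
    obtain ⟨g, hgd, rfl⟩ := mem_polySpan.mp hy
    obtain ⟨f, hfd, hf⟩ := mem_polySpan.mp hx1
    refine ⟨(f, g), ⟨⟨mem_degreeLT.mpr hfd, mem_degreeLT.mpr hgd⟩, ?_⟩, hf⟩
    simp [ψ, hf]
  refine (Submodule.finrank_mono hle).trans <| (Submodule.finrank_map_le _ _).trans ?_
  have hA : P.map Φ ≤
      (degreeLT Fq (i + m - t)).map (LinearMap.mulLeft Fq (minpoly Fq lam)) := by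
    rintro _ ⟨⟨f, g⟩, ⟨⟨hfd, hgd⟩, hker⟩, rfl⟩
    have hfd := mem_degreeLT.mp hfd
    have hgd := mem_degreeLT.mp hgd
    have hker : aeval lam f - α * aeval lam g = 0 := hker
    have hroot : aeval lam (g₀ * f - f₀ * g) = 0 := by
      rw [map_sub, map_mul, map_mul, hfg]
      linear_combination aeval lam g₀ * hker
    obtain ⟨h, hh⟩ := minpoly.dvd Fq lam hroot
    rcases eq_or_ne (g₀ * f - f₀ * g) 0 with hzero | hzero
    · exact ⟨0, Submodule.zero_mem _, (map_zero _).trans hzero.symm⟩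
    refine ⟨h, ?_, hh.symm⟩
    rw [SetLike.mem_coe, mem_degreeLT]
    have h0 : minpoly Fq lam ≠ 0 := left_ne_zero_of_mul (hh ▸ hzero)
    have hne : h ≠ 0 := right_ne_zero_of_mul (hh ▸ hzero)
    have hdeg : (g₀ * f - f₀ * g).degree < ((i + m : ℕ) : WithBot ℕ) := by
      have key : ∀ p r : Fq[X], p.natDegree ≤ i → r.degree < m →
          (p * r).degree < ((i + m : ℕ) : WithBot ℕ) := by
        intro p r hp hr
        rcases eq_or_ne r 0 with rfl | hne
        · simp
        rw [degree_eq_natDegree hne, Nat.cast_lt] at hr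
        refine degree_le_natDegree.trans_lt ?_
        have := natDegree_mul_le (p := p) (q := r)
        exact_mod_cast (by omega)
      exact (degree_sub_le _ _).trans_lt
        (max_lt (key _ _ (le_max_right _ _) hfd) (key _ _ (le_max_left _ _) hgd))
    rw [hh, degree_mul, degree_eq_natDegree h0, degree_eq_natDegree hne] at hdeg
    have : t + h.natDegree < i + m := by exact_mod_cast hdeg
    rw [degree_eq_natDegree hne]
    exact_mod_cast (by omega)
  have hB : P ⊓ LinearMap.ker Φ ≤ (degreeLT Fq (m - i)).map ι := by
    rintro ⟨f, g⟩ ⟨⟨⟨hfd, hgd⟩, -⟩, hker⟩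
    have hfd := mem_degreeLT.mp hfd
    have hgd := mem_degreeLT.mp hgd
    have hker : g₀ * f - f₀ * g = 0 := hker
    obtain ⟨h, rfl⟩ : g₀ ∣ g :=
      hcop.symm.dvd_of_dvd_mul_left ⟨f, by linear_combination -hker⟩
    obtain rfl : f = f₀ * h := mul_left_cancel₀ hg0 (by linear_combination hker)
    refine ⟨h, ?_, rfl⟩
    rw [SetLike.mem_coe, mem_degreeLT]
    rcases eq_or_ne h 0 with rfl | hne
    · simp
    dsimp only at hfd hgd
    rw [degree_eq_natDegree (mul_ne_zero hf0 hne), natDegree_mul hf0 hne, Nat.cast_lt] at hfd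
    rw [degree_eq_natDegree (mul_ne_zero hg0 hne), natDegree_mul hg0 hne, Nat.cast_lt] at hgd
    rw [degree_eq_natDegree hne]
    exact_mod_cast (by omega)
  refine (finrank_le_add_of_map_le_of_inf_ker_le Φ P _ _ hA hB).trans
    (add_le_add ?_ ?_)
  · exact (Submodule.finrank_map_le _ _).trans (finrank_degreeLT _).le
  · exact (Submodule.finrank_map_le _ _).trans (finrank_degreeLT _).le

lemma exists_isCoprime_of_inf_ne_bot {m : ℕ}
    (h : polySpan Fq lam m ⊓ smulSub Fq α (polySpan Fq lam m) ≠ ⊥) :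
    ∃ f g : Fq[X], IsCoprime f g ∧ max f.natDegree g.natDegree < m ∧ aeval lam g ≠ 0 ∧
      aeval lam f = α * aeval lam g := by
  obtain ⟨x, ⟨hx1, hx2⟩, hx0⟩ := Submodule.exists_mem_ne_zero_of_ne_bot h
  obtain ⟨y, hy, rfl⟩ := mem_smulSub.mp hx2
  obtain ⟨g, hgd, rfl⟩ := mem_polySpan.mp hy
  obtain ⟨f, hfd, hf⟩ := mem_polySpan.mp hx1
  have hg := right_ne_zero_of_mul hx0
  have hg0 : g ≠ 0 := by rintro rfl; simp at hg
  have hf0 : f ≠ 0 := by rintro rfl; exact hx0 (by simpa using hf.symm)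
  classical
  have hcop := isCoprime_div_gcd_div_gcd (p := f) hg0
  set d := GCDMonoid.gcd f g with hd
  obtain ⟨a, ha⟩ : d ∣ f := GCDMonoid.gcd_dvd_left _ _
  obtain ⟨b, hb⟩ : d ∣ g := GCDMonoid.gcd_dvd_right _ _
  have hd0 : d ≠ 0 := by intro h0; rw [h0, zero_mul] at hb; exact hg0 hb
  rw [← EuclideanDomain.eq_div_of_mul_eq_right hd0 ha.symm,
    ← EuclideanDomain.eq_div_of_mul_eq_right hd0 hb.symm] at hcop
  rw [ha, hb, map_mul, map_mul] at hf
  rw [hb, map_mul] at hg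
  refine ⟨a, b, hcop, ?_, right_ne_zero_of_mul hg,
    mul_left_cancel₀ (left_ne_zero_of_mul hg) (by linear_combination hf)⟩
  rw [degree_eq_natDegree hf0, Nat.cast_lt] at hfd
  rw [degree_eq_natDegree hg0, Nat.cast_lt] at hgd
  have h1 := natDegree_le_of_dvd ⟨d, ha.trans (mul_comm _ _)⟩ hf0
  have h2 := natDegree_le_of_dvd ⟨d, hb.trans (mul_comm _ _)⟩ hg0
  omega

end PolySpan

section Intersection

open Polynomial IntermediateField

variable {F : Type*} [Field F] {Fq : Subfield F} {lam α : F}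

/-- The dimension of `S ∩ αS`. -/
noncomputable def interDim (S : Submodule Fq F) (α : F) : ℕ :=
  finrank Fq ↥(S ⊓ smulSub Fq α S)

lemma polySpan_le_adjoin (m : ℕ) : polySpan Fq lam m ≤
    Subalgebra.toSubmodule Fq⟮lam⟯.toSubalgebra := by
  intro x hx
  obtain ⟨f, -, rfl⟩ := mem_polySpan.mp hx
  exact algebra_adjoin_le_adjoin Fq {lam} (aeval_mem_adjoin_singleton Fq lam)

lemma interDim_polySpan_eq_zero (hα : α ∉ Fq⟮lam⟯) (m : ℕ) :
    interDim (polySpan Fq lam m) α = 0 := by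
  rw [interDim, Submodule.finrank_eq_zero, Submodule.eq_bot_iff]
  rintro x ⟨hx1, hx2⟩
  obtain ⟨y, hy, rfl⟩ := mem_smulSub.mp hx2
  by_contra hne
  have hy0 := right_ne_zero_of_mul hne
  have := Fq⟮lam⟯.div_mem (polySpan_le_adjoin m hx1)
    (polySpan_le_adjoin m hy)
  rw [mul_div_cancel_right₀ _ hy0] at this
  exact hα this

lemma two_mul_sub_le_interDim (hint : IsIntegral Fq lam) (hα : α ∈ Fq⟮lam⟯) (hα0 : α ≠ 0)
    {m : ℕ} (hm : m ≤ (minpoly Fq lam).natDegree) :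
    2 * m - (minpoly Fq lam).natDegree ≤ interDim (polySpan Fq lam m) α := by
  have : FiniteDimensional Fq Fq⟮lam⟯ := adjoin.finiteDimensional hint
  have hK : Module.Finite Fq (Subalgebra.toSubmodule Fq⟮lam⟯.toSubalgebra) := this
  have hsup : polySpan Fq lam m ⊔ smulSub Fq α (polySpan Fq lam m) ≤
      Subalgebra.toSubmodule Fq⟮lam⟯.toSubalgebra := by
    refine sup_le (polySpan_le_adjoin m) ?_
    intro x hx
    obtain ⟨y, hy, rfl⟩ := mem_smulSub.mp hx
    exact Fq⟮lam⟯.mul_mem hα (polySpan_le_adjoin m hy)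
  have h1 := Submodule.finrank_mono hsup
  have h2 : finrank Fq (Subalgebra.toSubmodule Fq⟮lam⟯.toSubalgebra) =
    (minpoly Fq lam).natDegree := adjoin.finrank hint
  have h3 := Submodule.finrank_sup_add_finrank_inf_eq (polySpan Fq lam m)
    (smulSub Fq α (polySpan Fq lam m))
  rw [finrank_smulSub hα0, finrank_polySpan hm] at h3
  unfold interDim
  omega

lemma interDim_polySpan_of_le (hα0 : α ≠ 0) {k M : ℕ} (hk : k ≤ (minpoly Fq lam).natDegree)
    (hk2 : (minpoly Fq lam).natDegree < 2 * k) (hM : M ≤ (minpoly Fq lam).natDegree - k) :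
    interDim (polySpan Fq lam M) α = interDim (polySpan Fq lam k) α - (k - M) := by
  have hpos : ∀ m, interDim (polySpan Fq lam m) α ≠ 0 →
      polySpan Fq lam m ⊓ smulSub Fq α (polySpan Fq lam m) ≠ ⊥ := fun m h h' ↦ by
    simp [interDim, h'] at h
  by_cases hDM : interDim (polySpan Fq lam M) α = 0
  · by_cases hDk : interDim (polySpan Fq lam k) α = 0
    · omega
    obtain ⟨f, g, hcop, hlt, hg, hfg⟩ := exists_isCoprime_of_inf_ne_bot (hpos k hDk)
    have h1 := sub_le_finrank_inf hα0 hg hfg (m := M) (by omega)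
    have h2 := finrank_inf_le hα0 hcop hg hfg k
    unfold interDim at *
    omega
  · obtain ⟨f, g, hcop, hlt, hg, hfg⟩ := exists_isCoprime_of_inf_ne_bot (hpos M hDM)
    have h1 := sub_le_finrank_inf hα0 hg hfg (m := M) (by omega)
    have h2 := finrank_inf_le hα0 hcop hg hfg M
    have h3 := sub_le_finrank_inf hα0 hg hfg hk
    have h4 := finrank_inf_le hα0 hcop hg hfg k
    unfold interDim at *
    omega

lemma pow_add_ne_zero {i : ℕ} (hi : 1 ≤ i) (hit : i < (minpoly Fq lam).natDegree) (c : Fq) :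
    lam ^ i + c ≠ 0 := by
  intro h
  have h0 : (X ^ i + C c : Fq[X]) = 0 := by
    apply eq_zero_of_aeval_eq_zero (lam := lam)
    · rw [degree_X_pow_add_C (by omega)]
      exact_mod_cast hit
    · rw [map_add, map_pow, aeval_X, aeval_C]
      exact h
  exact (monic_X_pow_add_C c (by omega)).ne_zero h0

lemma interDim_polySpan_pow_add {i k : ℕ} (hi : 1 ≤ i) (hk1 : 1 ≤ k)
    (hk : k ≤ (minpoly Fq lam).natDegree)
    (hik : i ≤ (minpoly Fq lam).natDegree - k) (c : Fq) :
    interDim (polySpan Fq lam k) (lam ^ i + c) = k - i := by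
  have hα0 := pow_add_ne_zero (lam := lam) hi (by omega) c
  have hfg : aeval lam (X ^ i + C c : Fq[X]) = (lam ^ i + c) * aeval lam (1 : Fq[X]) := by
    simp; rfl
  have hg : aeval lam (1 : Fq[X]) ≠ 0 := by simp
  have h1 := sub_le_finrank_inf hα0 hg hfg hk
  have h2 := finrank_inf_le hα0 isCoprime_one_right hg hfg k
  rw [natDegree_X_pow_add_C, natDegree_one] at h1 h2
  unfold interDim
  omega

lemma smulSub_polySpan_eq_iff {β : F} (hα : α ≠ 0) {k : ℕ} (hk1 : 1 ≤ k)
    (hk : k < (minpoly Fq lam).natDegree) :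
    smulSub Fq β (polySpan Fq lam k) = smulSub Fq α (polySpan Fq lam k) ∧ β ≠ 0 ↔
      ∃ c : Fq, c ≠ 0 ∧ β = c * α := by
  constructor
  · rintro ⟨h, hβ⟩
    have hstab : ∀ x ∈ polySpan Fq lam k, β / α * x ∈ polySpan Fq lam k := by
      intro x hx
      have : β * x ∈ smulSub Fq α (polySpan Fq lam k) := h ▸ mem_smulSub.mpr ⟨x, hx, rfl⟩
      obtain ⟨y, hy, hxy⟩ := mem_smulSub.mp this
      rwa [div_mul_eq_mul_div, ← hxy, mul_div_cancel_left₀ _ hα]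
    have h1 : β / α * 1 ∈ polySpan Fq lam k := hstab 1 <|
      mem_polySpan.mpr ⟨1, by rw [degree_one]; exact_mod_cast hk1, by simp⟩
    obtain ⟨p, hp, hpv⟩ := mem_polySpan.mp h1
    rw [mul_one] at hpv
    have hp0 : p ≠ 0 := by
      rintro rfl
      exact div_ne_zero hβ hα (by simpa using hpv.symm)
    rw [degree_eq_natDegree hp0, Nat.cast_lt] at hp
    have hdeg : p.natDegree = 0 := by
      by_contra hpos
      have h2 := hstab (lam ^ (k - p.natDegree)) <| mem_polySpan.mpr
        ⟨X ^ (k - p.natDegree), by rw [degree_X_pow]; exact_mod_cast (by omega), by simp⟩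
      obtain ⟨r, hr, hrv⟩ := mem_polySpan.mp h2
      have hd : (p * X ^ (k - p.natDegree)).degree = (k : WithBot ℕ) := by
        rw [degree_mul, degree_X_pow, degree_eq_natDegree hp0]
        exact_mod_cast (by omega)
      have hd2 : (p * X ^ (k - p.natDegree) - r).degree = (k : WithBot ℕ) := by
        rw [degree_sub_eq_left_of_degree_lt (hd ▸ hr), hd]
      have hz := eq_zero_of_aeval_eq_zero (lam := lam) (f := p * X ^ (k - p.natDegree) - r)
        (by rw [hd2]; exact_mod_cast hk) (by simp [hrv, hpv])
      rw [hz, degree_zero] at hd2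
      cases hd2
    obtain ⟨c, rfl⟩ := natDegree_eq_zero.mp hdeg
    refine ⟨c, by rintro rfl; simp at hp0, ?_⟩
    rw [aeval_C] at hpv
    rw [← div_eq_iff hα, ← hpv]
    rfl
  · rintro ⟨c, hc, rfl⟩
    have hcF : (c : F) ≠ 0 := by simpa using hc
    refine ⟨?_, mul_ne_zero hcF hα⟩
    ext x
    simp only [mem_smulSub]
    constructor
    · rintro ⟨y, hy, rfl⟩
      exact ⟨c • y, Submodule.smul_mem _ _ hy, by rw [Subfield.smul_def, smul_eq_mul]; ring⟩
    · rintro ⟨y, hy, rfl⟩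
      refine ⟨c⁻¹ • y, Submodule.smul_mem _ _ hy, ?_⟩
      rw [Subfield.smul_def, smul_eq_mul, Subfield.coe_inv]
      field_simp

end Intersection

section Counting

open Finset

/-- The values `1, (q+1)q, (q+1)q³, …` satisfy the moment identities below. -/
lemma moment_identity (q : ℚ) (M : ℕ) :
    (∑ i ∈ range (M + 1), (q - 1) * (if i = 0 then 1 else (q + 1) * q ^ (2 * i - 1)) =
      q ^ (2 * M + 1) - 1) ∧
    ∑ i ∈ range (M + 1), (q - 1) * (if i = 0 then 1 else (q + 1) * q ^ (2 * i - 1)) *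
      (q ^ (M + 1 - i) - 1) = (q ^ (M + 1) - 1) ^ 2 := by
  induction M with
  | zero => simp; ring
  | succ M ih =>
    obtain ⟨ih1, ih2⟩ := ih
    have hs : ∑ i ∈ range (M + 1 + 1),
        (q - 1) * (if i = 0 then 1 else (q + 1) * q ^ (2 * i - 1)) =
          q ^ (2 * (M + 1) + 1) - 1 := by
      rw [sum_range_succ, ih1, if_neg (Nat.succ_ne_zero M),
        show 2 * (M + 1) - 1 = 2 * M + 1 by omega]
      ring
    refine ⟨hs, ?_⟩
    have hstep : ∀ i ∈ range (M + 1),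
        (q - 1) * (if i = 0 then 1 else (q + 1) * q ^ (2 * i - 1)) * (q ^ (M + 1 + 1 - i) - 1) =
        q * ((q - 1) * (if i = 0 then 1 else (q + 1) * q ^ (2 * i - 1)) *
          (q ^ (M + 1 - i) - 1)) +
        (q - 1) * ((q - 1) * (if i = 0 then 1 else (q + 1) * q ^ (2 * i - 1))) := by
      intro i hi
      rw [show M + 1 + 1 - i = (M + 1 - i) + 1 by grind, pow_succ]
      ring
    rw [sum_range_succ, sum_congr rfl hstep, sum_add_distrib, ← mul_sum, ← mul_sum, ih1, ih2,
      if_neg (Nat.succ_ne_zero M), show 2 * (M + 1) - 1 = 2 * M + 1 by omega,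
      show M + 1 + 1 - (M + 1) = 1 by omega]
    ring

lemma eq_of_moments {q : ℚ} (hq : q ≠ 1) {b : ℕ} {w : ℕ → ℚ}
    (h : ∀ M ≤ b, ∑ i ∈ range M, (q - 1) * w i * (q ^ (M - i) - 1) = (q ^ M - 1) ^ 2)
    (i : ℕ) (hi : i < b) : w i = if i = 0 then 1 else (q + 1) * q ^ (2 * i - 1) := by
  induction i using Nat.strong_induction_on with
  | _ i ih =>
    have h1 := h (i + 1) hi
    rw [← (moment_identity q i).2, sum_range_succ, sum_range_succ,
      sum_congr rfl fun j hj ↦ by rw [ih j (by simpa using hj) (by grind)]] at h1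
    have h2 := add_left_cancel h1
    rw [show i + 1 - i = 1 by omega, pow_one] at h2
    have hq' : q - 1 ≠ 0 := sub_ne_zero.mpr hq
    exact mul_left_cancel₀ hq' (mul_right_cancel₀ hq' h2)

variable {F : Type*} [Field F] {Fq : Subfield F}

lemma sum_card_pow_interDim [Fintype F] [DecidableEq F] (S : Submodule Fq F) :
    ∑ α : F with α ≠ 0, ((Nat.card Fq : ℚ) ^ interDim S α - 1) =
      ((Nat.card Fq : ℚ) ^ finrank Fq S - 1) ^ 2 := by
  classical
  have hcard : ∀ T : Submodule Fq F,
      ((#{x : F | x ∈ T ∧ x ≠ 0} : ℕ) : ℚ) = (Nat.card Fq : ℚ) ^ finrank Fq T - 1 := by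
    intro T
    have h1 : #{x : F | x ∈ T} = Nat.card Fq ^ finrank Fq T := by
      rw [← Module.natCard_eq_pow_finrank, ← Fintype.card_subtype, ← Nat.card_eq_fintype_card]
    have h2 : ({x : F | x ∈ T ∧ x ≠ 0} : Finset F) = ({x : F | x ∈ T} : Finset F).erase 0 := by
      ext x; simp [and_comm]
    rw [h2, cast_card_erase_of_mem (by simp), h1, Nat.cast_pow]
  set A : Finset F := {x : F | x ∈ S ∧ x ≠ 0} with hA
  have hmaps : Set.MapsTo (fun p : F × F ↦ p.1 / p.2) (A ×ˢ A : Finset (F × F))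
      ({α : F | α ≠ 0} : Finset F) := by
    intro p hp
    simp only [hA, coe_product, Set.mem_prod, mem_coe, mem_filter, mem_univ, true_and] at hp ⊢
    exact div_ne_zero hp.1.2 hp.2.2
  have hfib := card_eq_sum_card_fiberwise hmaps
  rw [card_product] at hfib
  rw [← hcard S, sq, ← Nat.cast_mul, hfib, Nat.cast_sum]
  refine sum_congr rfl fun α hα ↦ ?_
  have hα0 : α ≠ 0 := by simpa using hα
  rw [interDim, ← hcard]
  congr 1
  refine card_nbij' (fun x ↦ (x, x / α)) Prod.fst ?_ ?_ ?_ ?_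
  · intro x hx
    simp only [coe_filter, mem_univ, true_and, Set.mem_ofPred_eq, Submodule.mem_inf,
      mem_smulSub] at hx
    obtain ⟨⟨hx1, y, hy, rfl⟩, hx0⟩ := hx
    have hy0 := right_ne_zero_of_mul hx0
    simp [hA, hx1, hy, hα0, hy0, mul_div_cancel_left₀]
  · rintro ⟨u, v⟩ hp
    simp only [hA, coe_filter, mem_product, mem_filter, mem_univ, true_and,
      Set.mem_ofPred_eq] at hp
    obtain ⟨⟨⟨hu, hu0⟩, hv, hv0⟩, rfl⟩ := hp
    simp only [coe_filter, mem_univ, true_and, Set.mem_ofPred_eq, Submodule.mem_inf, mem_smulSub]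
    exact ⟨⟨hu, v, hv, div_mul_cancel₀ _ hv0⟩, hu0⟩
  · intro x hx
    rfl
  · rintro ⟨u, v⟩ hp
    simp only [hA, coe_filter, mem_product, mem_filter, mem_univ, true_and,
      Set.mem_ofPred_eq] at hp
    obtain ⟨⟨⟨hu, hu0⟩, hv, hv0⟩, rfl⟩ := hp
    simp [div_div_cancel₀ hu0]

variable {S : Submodule Fq F}

/-- If `S` has stabilizer `Fq`, each `αS` arises from `q - 1` values of `α`. -/
lemma card_interDim_eq [Fintype F] [DecidableEq F]
    (hstab : ∀ α β : F, α ≠ 0 → (smulSub Fq β S = smulSub Fq α S ∧ β ≠ 0 ↔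
      ∃ c : Fq, c ≠ 0 ∧ β = c * α)) (d : ℕ) :
    (#{α : F | α ≠ 0 ∧ interDim S α = d} : ℚ) = ((Nat.card Fq : ℚ) - 1) * wt Fq S d := by
  classical
  set W : Set (Submodule Fq F) := {T | T ∈ Orb Fq S ∧ finrank Fq ↥(S ⊓ T) = d}
  have hrep : ∀ T : W, ∃ α : F, α ≠ 0 ∧ T.1 = smulSub Fq α S := fun T ↦ T.2.1
  choose a ha0 ha using hrep
  let e : {c : Fq // c ≠ 0} × W → {α : F // α ≠ 0 ∧ interDim S α = d} := fun p ↦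
    ⟨p.1 * a p.2, by
      have h := (hstab (a p.2) (p.1 * a p.2) (ha0 _)).mpr ⟨p.1, p.1.2, rfl⟩
      refine ⟨h.2, ?_⟩
      rw [interDim, h.1, ← ha]
      exact p.2.2.2⟩
  have he : Function.Bijective e := by
    constructor
    · rintro ⟨c, T⟩ ⟨c', T'⟩ h
      have h : (c : F) * a T = c' * a T' := congrArg Subtype.val h
      have h1 := ((hstab (a T) (c * a T) (ha0 _)).mpr ⟨c, c.2, rfl⟩).1
      have h2 := ((hstab (a T') (c' * a T') (ha0 _)).mpr ⟨c', c'.2, rfl⟩).1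
      have hT : T = T' := Subtype.ext (by rw [ha, ha, ← h1, ← h2, h])
      subst hT
      have hc := mul_right_cancel₀ (ha0 T) h
      rw [Subtype.ext (Subtype.ext hc : c.1 = c'.1)]
    · rintro ⟨α, hα, hd⟩
      let T : W := ⟨smulSub Fq α S, ⟨α, hα, rfl⟩, hd⟩
      obtain ⟨c, hc, h⟩ := (hstab (a T) α (ha0 T)).mp ⟨ha T, hα⟩
      exact ⟨(⟨c, hc⟩, T), Subtype.ext h.symm⟩
  have h := Nat.card_congr (Equiv.ofBijective e he)
  rw [Nat.card_prod, Nat.card_eq_fintype_card (α := {α : F // _}), Fintype.card_subtype] at h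
  have hc : Nat.card {c : Fq // c ≠ 0} = Nat.card Fq - 1 := by
    rw [Nat.card_eq_fintype_card, Nat.card_eq_fintype_card, Fintype.card_subtype_compl,
      Fintype.card_subtype_eq]
  rw [← h, hc, Nat.cast_mul, Nat.cast_sub Nat.card_pos, Nat.cast_one]
  rfl

/-- Summation over `α ≠ 0` of a function of `dim (S ∩ αS)`, grouped by codimension. -/
lemma sum_interDim_eq [Fintype F] [DecidableEq F]
    (hstab : ∀ α β : F, α ≠ 0 → (smulSub Fq β S = smulSub Fq α S ∧ β ≠ 0 ↔
      ∃ c : Fq, c ≠ 0 ∧ β = c * α)) (φ : ℕ → ℚ) :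
    ∑ α : F with α ≠ 0, φ (interDim S α) =
      ∑ i ∈ range (finrank Fq S + 1), ((Nat.card Fq : ℚ) - 1) * wt Fq S (finrank Fq S - i) *
        φ (finrank Fq S - i) := by
  have hmaps : ∀ α ∈ ({α : F | α ≠ 0} : Finset F),
      interDim S α ∈ range (finrank Fq S + 1) := by
    intro α _
    rw [mem_range, Nat.lt_succ_iff]
    exact Submodule.finrank_mono inf_le_left
  rw [← sum_fiberwise_of_maps_to hmaps, ← sum_range_reflect]
  refine sum_congr rfl fun i _ ↦ ?_
  rw [show finrank Fq S + 1 - 1 - i = finrank Fq S - i by omega, ← card_interDim_eq hstab,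
    filter_filter, sum_congr rfl fun α hα ↦ by rw [(mem_filter.mp hα).2.2], sum_const,
    nsmul_eq_mul]

lemma wt_eq_zero_of_forall_ne {d : ℕ} (h : ∀ α : F, α ≠ 0 → interDim S α ≠ d) :
    wt Fq S d = 0 := by
  have hempty : {T | T ∈ Orb Fq S ∧ finrank Fq ↥(S ⊓ T) = d} = ∅ := by
    refine Set.eq_empty_of_forall_notMem ?_
    rintro _ ⟨⟨α, hα, rfl⟩, hd⟩
    exact h α hα hd
  rw [wt, hempty, Set.ncard_empty]

/-- Over an infinite `Fq`, a line `β + Fq` of constant intersection dimension `d` gives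
infinitely many codewords. -/
lemma wt_eq_zero_of_infinite [Infinite Fq]
    (hstab : ∀ α β : F, α ≠ 0 → (smulSub Fq β S = smulSub Fq α S ∧ β ≠ 0 ↔
      ∃ c : Fq, c ≠ 0 ∧ β = c * α)) {β : F} (hβ : β ∉ Fq) {d : ℕ}
    (hd : ∀ c : Fq, interDim S (β + c) = d) : wt Fq S d = 0 := by
  have hne : ∀ c : Fq, β + c ≠ 0 := fun c h ↦
    hβ (by rw [eq_neg_of_add_eq_zero_left h]; exact neg_mem c.2)
  apply Set.Infinite.ncard
  refine Set.infinite_of_injective_forall_mem (f := fun c : Fq ↦ smulSub Fq (β + c) S) ?_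
    fun c ↦ ⟨⟨_, hne c, rfl⟩, hd c⟩
  intro c c' h
  obtain ⟨e, -, he⟩ := (hstab _ _ (hne c')).mp ⟨h, hne c⟩
  by_cases h1 : e = 1
  · subst h1
    simpa using he
  · have h1' : (1 - e : F) ≠ 0 := sub_ne_zero.mpr fun h ↦ h1 (Subtype.ext h.symm)
    refine absurd ?_ hβ
    have : β = ((e * c' - c) / (1 - e) : Fq) := by
      push_cast
      rw [eq_div_iff h1']
      linear_combination he
    rw [this]
    exact Subtype.property _

end Counting

open IntermediateField

/-- for `S = ⟨1, λ, …, λ^{k-1}⟩_{Fq}` with `1 ≤ k < t` and `2k > t`: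
`ω_{2i}(Orb S) = (q+1)q^{2i-1}` for `i ∈ {1, …, t-k-1}`,
`ω_{2(t-k)}(Orb S) = (q^t - q^{2(t-k)-1})/(q-1)`, `ω_{2i}(Orb S) = 0` for
`i ∈ {t-k+1, …, k-1}`, and `ω_{2k}(Orb S) = (q^n - q^t)/(q-1)`. -/
theorem stmt19 (q n : ℕ) (hn : 0 < n)
    (F : Type*) [Field F] (hF : Nat.card F = q ^ n)
    (Fq : Subfield F) (hq : Nat.card Fq = q)
    (lam : F) (hlam : lam ∉ Fq)
    (t : ℕ) (ht : t = (minpoly Fq lam).natDegree)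
    (k : ℕ) (hk1 : 1 ≤ k) (hk2 : k < t) (hk3 : t < 2 * k)
    (S : Submodule Fq F)
    (hS : S = Submodule.span Fq {x : F | ∃ j < k, x = lam ^ j}) :
    (∀ i : ℕ, 1 ≤ i → i ≤ t - k - 1 →
        wt Fq S (k - i) = (q + 1) * q ^ (2 * i - 1)) ∧
      (wt Fq S (k - (t - k)) : ℚ) =
        ((q : ℚ) ^ t - (q : ℚ) ^ (2 * (t - k) - 1)) / ((q : ℚ) - 1) ∧
      (∀ i : ℕ, t - k + 1 ≤ i → i ≤ k - 1 → wt Fq S (k - i) = 0) ∧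
      (wt Fq S 0 : ℚ) = ((q : ℚ) ^ n - (q : ℚ) ^ t) / ((q : ℚ) - 1) := by
  rw [span_pow_eq_polySpan] at hS
  subst hS ht
  set t := (minpoly Fq lam).natDegree with ht
  have hint : IsIntegral Fq lam := by
    by_contra h
    rw [minpoly.eq_zero h, Polynomial.natDegree_zero] at ht
    omega
  have hstab : ∀ α β : F, α ≠ 0 → (smulSub Fq β (polySpan Fq lam k) =
      smulSub Fq α (polySpan Fq lam k) ∧ β ≠ 0 ↔ ∃ c : Fq, c ≠ 0 ∧ β = c * α) :=
    fun α β hα ↦ smulSub_polySpan_eq_iff hα hk1 hk2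
  have hgap : ∀ i : ℕ, t - k + 1 ≤ i → i ≤ k - 1 → wt Fq (polySpan Fq lam k) (k - i) = 0 := by
    intro i hi1 hi2
    refine wt_eq_zero_of_forall_ne fun α hα hd ↦ ?_
    by_cases hmem : α ∈ Fq⟮lam⟯
    · have := two_mul_sub_le_interDim hint hmem hα hk2.le
      omega
    · rw [interDim_polySpan_eq_zero hmem] at hd
      omega
  rcases finite_or_infinite Fq with hfin | hinf
  · have hq1 : 1 < q := hq ▸ Finite.one_lt_card
    have hFfin : Finite F := Nat.finite_of_card_ne_zero (by rw [hF]; positivity)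
    have := Fintype.ofFinite F
    classical
    have hq0 : (q : ℚ) - 1 ≠ 0 := sub_ne_zero.mpr (by exact_mod_cast hq1.ne')
    have hrank := finrank_polySpan (Fq := Fq) (lam := lam) hk2.le
    have hsum := sum_interDim_eq hstab
    rw [hrank, hq] at hsum
    have hlow := eq_of_moments (q := q) (by exact_mod_cast hq1.ne') (b := t - k)
      (w := fun i ↦ wt Fq (polySpan Fq lam k) (k - i)) fun M hM ↦ by
        have h1 := sum_card_pow_interDim (polySpan Fq lam M)
        rw [finrank_polySpan (by omega), hq] at h1
        have h2 : ∑ α : F with α ≠ 0, ((q : ℚ) ^ interDim (polySpan Fq lam M) α - 1) =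
            ∑ α : F with α ≠ 0, ((q : ℚ) ^ (interDim (polySpan Fq lam k) α - (k - M)) - 1) :=
          Finset.sum_congr rfl fun α hα ↦ by
            rw [interDim_polySpan_of_le (by simpa using hα) hk2.le hk3 hM]
        rw [← h1, h2, hsum fun d ↦ (q : ℚ) ^ (d - (k - M)) - 1]
        refine (Finset.sum_subset_zero_on_sdiff (Finset.range_mono (by omega)) ?_ ?_)
        · intro i hi
          simp only [Finset.mem_sdiff, Finset.mem_range] at hi
          rw [show k - i - (k - M) = 0 by omega]
          simp
        · intro i hi
          rw [Finset.mem_range] at hi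
          rw [show k - i - (k - M) = M - i by omega]
    have hzero : ((q : ℚ) - 1) * wt Fq (polySpan Fq lam k) 0 = (q : ℚ) ^ n - (q : ℚ) ^ t := by
      have h1 := card_interDim_eq hstab 0
      rw [hq] at h1
      rw [← h1]
      have h2 : ({α : F | α ≠ 0 ∧ interDim (polySpan Fq lam k) α = 0} : Finset F) =
          ({α : F | α ∈ Fq⟮lam⟯} : Finset F)ᶜ := by
        ext α
        simp only [Finset.mem_filter, Finset.mem_univ, true_and, Finset.mem_compl]
        refine ⟨fun ⟨hα, hd⟩ hmem ↦ ?_, fun hmem ↦ ⟨?_, interDim_polySpan_eq_zero hmem k⟩⟩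
        · have := two_mul_sub_le_interDim hint hmem hα hk2.le
          omega
        · rintro rfl
          exact hmem (zero_mem _)
      have h3 : Finset.card ({α : F | α ∈ Fq⟮lam⟯} : Finset F) = q ^ t := by
        rw [← Fintype.card_subtype, ← Nat.card_eq_fintype_card, ht, ← adjoin.finrank hint, ← hq]
        exact Module.natCard_eq_pow_finrank
      have h4 := Finset.card_add_card_compl ({α : F | α ∈ Fq⟮lam⟯} : Finset F)
      rw [h3, ← Nat.card_eq_fintype_card, hF] at h4
      rw [h2, eq_sub_iff_add_eq']
      exact_mod_cast h4
    refine ⟨fun i hi1 hi2 ↦ ?_, ?_, hgap, ?_⟩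
    · have := hlow i (by omega)
      rw [if_neg (by omega)] at this
      exact_mod_cast this
    · have htot := hsum fun _ ↦ 1
      have hcard : ∑ α : F with α ≠ 0, (1 : ℚ) = q ^ n - 1 := by
        rw [Finset.sum_const, nsmul_one, Finset.filter_ne', Finset.cast_card_erase_of_mem
          (Finset.mem_univ _), Finset.card_univ, ← Nat.card_eq_fintype_card, hF, Nat.cast_pow]
      have htail : ∑ i ∈ Finset.range k,
          ((q : ℚ) - 1) * wt Fq (polySpan Fq lam k) (k - i) * 1 =
          ∑ i ∈ Finset.range (t - k + 1),
            ((q : ℚ) - 1) * wt Fq (polySpan Fq lam k) (k - i) * 1 := by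
        refine (Finset.sum_subset (Finset.range_mono (by omega)) fun i hi1 hi2 ↦ ?_).symm
        rw [Finset.mem_range] at hi1 hi2
        rw [hgap i (by omega) (by omega)]
        simp
      have hhead : ∑ i ∈ Finset.range (t - k),
          ((q : ℚ) - 1) * wt Fq (polySpan Fq lam k) (k - i) * 1 =
          (q : ℚ) ^ (2 * (t - k) - 1) - 1 := by
        have h1 := (moment_identity q (t - k - 1)).1
        rw [show t - k - 1 + 1 = t - k by omega,
          show 2 * (t - k - 1) + 1 = 2 * (t - k) - 1 by omega] at h1
        rw [← h1]
        refine Finset.sum_congr rfl fun i hi ↦ ?_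
        rw [mul_one, hlow i (Finset.mem_range.mp hi)]
      rw [hcard, Finset.sum_range_succ, htail, Finset.sum_range_succ, hhead, Nat.sub_self,
        hzero] at htot
      rw [eq_div_iff hq0]
      linear_combination -htot
    · rw [eq_div_iff hq0, ← hzero, mul_comm]
  · obtain rfl : q = 0 := by rw [← hq, Nat.card_eq_zero_of_infinite]
    have hpow : ∀ i, 1 ≤ i → i ≤ t - k → wt Fq (polySpan Fq lam k) (k - i) = 0 := by
      intro i hi1 hi2
      refine wt_eq_zero_of_infinite hstab (β := lam ^ i) (fun hmem ↦ ?_)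
        (interDim_polySpan_pow_add hi1 hk1 hk2.le hi2)
      exact pow_add_ne_zero (lam := lam) hi1 (by omega) (-⟨lam ^ i, hmem⟩) (by simp)
    refine ⟨fun i hi1 hi2 ↦ ?_, ?_, hgap, ?_⟩
    · rw [hpow i hi1 (by omega), zero_pow (by omega), mul_zero]
    · rw [hpow _ (by omega) le_rfl]
      simp [show t ≠ 0 by omega, show 2 * (t - k) - 1 ≠ 0 by omega]
    · suffices h : wt Fq (polySpan Fq lam k) 0 = 0 by
        simp [h, hn.ne', show t ≠ 0 by omega]
      by_cases hall : ∀ β : F, β ∈ Fq⟮lam⟯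
      · refine wt_eq_zero_of_forall_ne fun α hα hd ↦ ?_
        have := two_mul_sub_le_interDim hint (hall α) hα hk2.le
        omega
      · push Not at hall
        obtain ⟨β, hβ⟩ := hall
        have hc : ∀ c : Fq, (c : F) ∈ Fq⟮lam⟯ := fun c ↦ Fq⟮lam⟯.algebraMap_mem c
        refine wt_eq_zero_of_infinite hstab (fun hmem ↦ hβ (hc ⟨β, hmem⟩)) fun c ↦ ?_
        refine interDim_polySpan_eq_zero (fun hmem ↦ hβ ?_) k
        simpa using sub_mem hmem (hc c)
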